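/- For every even integer N ≥ 4, the LGL interval immediately to the left of the origin satisfies 3/(2N+1) ≤ |Δ_{N/2−1}^N| ≤ (4N−4)/N². -/

import Mathlib

/-- The Legendre polynomial of degree `N` via the Rodrigues formula. -/
noncomputable def legendrePoly (N : ℕ) : Polynomial ℝ :=
  Polynomial.C (1 / (2 ^ N * N.factorial : ℝ)) *
    Polynomial.derivative^[N] ((Polynomial.X ^ 2 - 1) ^ N)

/-- The polynomial `(1 - x²)·L_N'(x)` whose zeros are the LGL nodes of order `N`. -/
noncomputable def lglPoly (N : ℕ) : Polynomial ℝ :=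
  (1 - Polynomial.X ^ 2) * Polynomial.derivative (legendrePoly N)

/-- `ξ 0 < ξ 1 < ⋯ < ξ N` enumerates the Legendre-Gauss-Lobatto nodes of order `N`
in increasing order. -/
def IsLGLNodes (N : ℕ) (ξ : ℕ → ℝ) : Prop :=
  StrictMonoOn ξ (Set.Iic N) ∧ ξ 0 = -1 ∧ ξ N = 1 ∧
    (∀ k ≤ N, (lglPoly N).eval (ξ k) = 0) ∧
    (∀ x : ℝ, (lglPoly N).eval x = 0 → ∃ k ≤ N, ξ k = x)

open Polynomial in
/-- The `k`-fold derivative of `(X² - 1) u' = 2 N X u`, where `u = (X² - 1) ^ N`. -/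
theorem iterate_derivative_X_sq_sub_one_pow_ode (N k : ℕ) :
    ((X : ℝ[X]) ^ 2 - 1) * derivative^[k + 2] ((X ^ 2 - 1) ^ N)
      + 2 * ((k : ℝ[X]) + 1) * X * derivative^[k + 1] ((X ^ 2 - 1) ^ N)
      + ((k : ℝ[X]) + 1) * (k : ℝ[X]) * derivative^[k] ((X ^ 2 - 1) ^ N)
    = 2 * (N : ℝ[X]) * (X * derivative^[k + 1] ((X ^ 2 - 1) ^ N)
      + ((k : ℝ[X]) + 1) * derivative^[k] ((X ^ 2 - 1) ^ N)) := by
  induction k with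
  | zero =>
    have h : ((X : ℝ[X]) ^ 2 - 1) * derivative ((X ^ 2 - 1) ^ N)
        = 2 * (N : ℝ[X]) * (X * (X ^ 2 - 1) ^ N) := by
      cases N with
      | zero => simp
      | succ n =>
        simp only [derivative_pow, derivative_sub, derivative_X, derivative_one, map_natCast,
          add_tsub_cancel_right]
        push_cast
        ring
    simp only [Function.iterate_succ_apply', Function.iterate_zero, id]
    generalize ((X : ℝ[X]) ^ 2 - 1) ^ N = p at h ⊢
    have h' := congrArg derivative h
    simp only [derivative_mul, derivative_sub, derivative_X_pow, derivative_X, derivative_one,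
      derivative_natCast, derivative_ofNat, map_natCast] at h'
    push_cast at h' ⊢
    linear_combination h'
  | succ k ih =>
    have h := congrArg derivative ih
    simp only [Function.iterate_succ_apply'] at h ⊢
    generalize derivative^[k] (((X : ℝ[X]) ^ 2 - 1) ^ N) = p at h ⊢
    simp only [derivative_mul, derivative_add, derivative_sub, derivative_X_pow, derivative_X,
      derivative_one, derivative_natCast, derivative_ofNat] at h
    simp only [map_natCast] at h
    push_cast at h ⊢
    linear_combination h

open Polynomial in
/-- Legendre's equation. -/
theorem legendrePoly_ode (N : ℕ) :
    ((X : ℝ[X]) ^ 2 - 1) * derivative (derivative (legendrePoly N))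
      + 2 * X * derivative (legendrePoly N) = (N : ℝ[X]) * ((N : ℝ[X]) + 1) * legendrePoly N := by
  have h := iterate_derivative_X_sq_sub_one_pow_ode N N
  simp only [Function.iterate_succ_apply'] at h
  simp only [legendrePoly, derivative_C_mul]
  linear_combination (C (1 / (2 ^ N * N.factorial : ℝ))) * h

open Polynomial in
theorem derivative_lglPoly (N : ℕ) :
    derivative (lglPoly N) = -((N : ℝ[X]) * ((N : ℝ[X]) + 1) * legendrePoly N) := by
  have h := legendrePoly_ode N
  simp only [lglPoly, derivative_mul, derivative_sub, derivative_one, derivative_X_pow]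
  simp only [map_natCast]
  push_cast
  linear_combination -h

open Polynomial in
theorem iterate_derivative_comp_neg_X_of_even {p : ℝ[X]} (hp : p.comp (-X) = p) (k : ℕ) :
    (derivative^[k] p).comp (-X) = (-1) ^ k * derivative^[k] p := by
  induction k with
  | zero => simpa using hp
  | succ k ih =>
    have h := congrArg derivative ih
    rw [derivative_comp, show ((-1 : ℝ[X]) ^ k) = C ((-1) ^ k) by simp, derivative_C_mul] at h
    simp only [derivative_neg, derivative_X] at h
    rw [Function.iterate_succ_apply']
    simp only [map_pow, map_neg, map_one] at h
    rw [pow_succ]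
    linear_combination -h

open Polynomial in
theorem eval_neg_lglPoly (N : ℕ) (x : ℝ) :
    (lglPoly N).eval (-x) = (-1) ^ (N + 1) * (lglPoly N).eval x := by
  have hu : (((X : ℝ[X]) ^ 2 - 1) ^ N).comp (-X) = (X ^ 2 - 1) ^ N := by simp
  have h := congrArg (eval x) (iterate_derivative_comp_neg_X_of_even hu (N + 1))
  rw [Function.iterate_succ_apply'] at h
  simp only [eval_comp, eval_neg, eval_X, eval_mul, eval_pow, eval_one] at h
  simp only [lglPoly, legendrePoly, derivative_C_mul, eval_mul, eval_C, eval_sub, eval_one,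
    eval_pow, eval_X, h]
  ring

/-- The Legendre-Gauss-Lobatto nodes are symmetric about the origin. -/
theorem IsLGLNodes.neg_apply_sub {N : ℕ} {ξ : ℕ → ℝ} (hξ : IsLGLNodes N ξ) {k : ℕ}
    (hk : k ≤ N) : -ξ (N - k) = ξ k := by
  obtain ⟨hmono, -, -, hroot, hsurj⟩ := hξ
  have hneg : ∀ x, (lglPoly N).eval x = 0 → (lglPoly N).eval (-x) = 0 := fun x hx => by
    rw [eval_neg_lglPoly, hx, mul_zero]
  have hf : StrictMono fun i : Fin (N + 1) => ξ i := fun i j hij =>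
    hmono (Set.mem_Iic.2 (by omega)) (Set.mem_Iic.2 (by omega)) hij
  have hg : StrictMono fun i : Fin (N + 1) => -ξ (N - i) := fun i j hij => by
    have : (i : ℕ) < j := hij
    exact neg_lt_neg (hmono (Set.mem_Iic.2 (by omega)) (Set.mem_Iic.2 (by omega)) (by omega))
  have hrange : (Set.range fun i : Fin (N + 1) => -ξ (N - i)) =
      Set.range fun i : Fin (N + 1) => ξ i := by
    ext x
    constructor
    · rintro ⟨i, rfl⟩
      obtain ⟨j, hj, hj'⟩ := hsurj _ (hneg _ (hroot (N - i) (by omega)))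
      exact ⟨⟨j, by omega⟩, hj'⟩
    · rintro ⟨i, rfl⟩
      obtain ⟨j, hj, hj'⟩ := hsurj _ (hneg _ (hroot i (by omega)))
      refine ⟨⟨N - j, by omega⟩, ?_⟩
      simp only [Nat.sub_sub_self hj, hj', neg_neg]
  exact congrFun ((hg.range_inj hf).1 hrange) ⟨k, by omega⟩

/-- If `m < 0` and `0` are consecutive zeros of `lglPoly N`, then Sturm
comparison with `sin (π x / m)` is an equality of coefficients at some intermediate point. -/
theorem exists_sturm_comparison_lglPoly {N : ℕ} {m : ℝ} (hm0 : m < 0)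
    (h0 : (lglPoly N).eval 0 = 0) (hmr : (lglPoly N).eval m = 0)
    (hne : ∀ x ∈ Set.Ioo m 0, (lglPoly N).eval x ≠ 0) :
    ∃ c ∈ Set.Ioo m 0, Real.pi ^ 2 * (1 - c ^ 2) = N * (N + 1) * m ^ 2 := by
  set K : ℝ := Real.pi / m with hK
  let F : ℝ → ℝ := fun x => (lglPoly N).derivative.eval x * Real.sin (K * x)
    - (lglPoly N).eval x * (Real.cos (K * x) * K)
  let F' : ℝ → ℝ := fun x => (lglPoly N).derivative.derivative.eval x * Real.sin (K * x)
    + K ^ 2 * (lglPoly N).eval x * Real.sin (K * x)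
  have hF : ∀ x, HasDerivAt F (F' x) x := fun x => by
    have hlin : HasDerivAt (fun x : ℝ => K * x) K x := by
      simpa using (hasDerivAt_id x).const_mul K
    have h := (((lglPoly N).derivative.hasDerivAt x).mul hlin.sin).sub
      (((lglPoly N).hasDerivAt x).mul (hlin.cos.mul_const K))
    exact h.congr_deriv (by simp only [F']; ring)
  have hKm : K * m = Real.pi := div_mul_cancel₀ _ hm0.ne
  have hFm : F m = F 0 := by simp [F, hKm, h0, hmr]
  obtain ⟨c, hc, hc'⟩ := exists_hasDerivAt_eq_zero hm0
    (fun x _ => (hF x).continuousAt.continuousWithinAt) hFm (fun x _ => hF x)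
  refine ⟨c, hc, ?_⟩
  obtain ⟨hc1, hc2⟩ := hc
  have hsin : Real.sin (K * c) ≠ 0 := by
    have hKneg : K < 0 := div_neg_of_pos_of_neg Real.pi_pos hm0
    refine (Real.sin_pos_of_pos_of_lt_pi (mul_pos_of_neg_of_neg hKneg hc2) ?_).ne'
    rw [← hKm]
    exact mul_lt_mul_of_neg_left hc1 hKneg
  have hw := hne c ⟨hc1, hc2⟩
  have hsum : (lglPoly N).derivative.derivative.eval c + K ^ 2 * (lglPoly N).eval c = 0 := by
    apply (mul_eq_zero.1 (?_ : _ * Real.sin (K * c) = 0)).resolve_right hsin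
    rw [add_mul]
    exact hc'
  have hode : (1 - c ^ 2) * (lglPoly N).derivative.derivative.eval c
      = -(N * (N + 1) * (lglPoly N).eval c) := by
    have h1 : (lglPoly N).derivative.derivative
        = -((N : Polynomial ℝ) * ((N : Polynomial ℝ) + 1) * (legendrePoly N).derivative) := by
      rw [derivative_lglPoly]
      simp [Polynomial.derivative_mul]
    rw [h1]
    simp only [lglPoly, Polynomial.eval_neg, Polynomial.eval_mul, Polynomial.eval_add,
      Polynomial.eval_natCast, Polynomial.eval_one, Polynomial.eval_sub, Polynomial.eval_pow,
      Polynomial.eval_X]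
    ring
  have hmul : (lglPoly N).eval c * (K ^ 2 * (1 - c ^ 2)) = (lglPoly N).eval c * (N * (N + 1)) := by
    linear_combination (1 - c ^ 2) * hsum - hode
  have hKc := mul_left_cancel₀ hw hmul
  rw [← hKm]
  linear_combination m ^ 2 * hKc

/-- Bounds on the LGL interval immediately to the left of the origin for even
order: for even `N ≥ 4`, `3/(2N+1) ≤ |Δ_{N/2-1}^N| ≤ (4N-4)/N²`. -/
theorem lgl_interval_bounds_even (N : ℕ) (hN : 4 ≤ N) (heven : Even N)
    (ξ : ℕ → ℝ) (hξ : IsLGLNodes N ξ) :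
    3 / (2 * (N : ℝ) + 1) ≤ ξ (N / 2) - ξ (N / 2 - 1) ∧
    ξ (N / 2) - ξ (N / 2 - 1) ≤ (4 * (N : ℝ) - 4) / (N : ℝ) ^ 2 := by
  have heven' : N = 2 * (N / 2) := (Nat.two_mul_div_two_of_even heven).symm
  have hmid : ξ (N / 2) = 0 := by
    have h := hξ.neg_apply_sub (Nat.div_le_self N 2)
    rw [show N - N / 2 = N / 2 by omega] at h
    linarith
  obtain ⟨hmono, -, -, hroot, hsurj⟩ := hξ
  have hm0 : ξ (N / 2 - 1) < 0 := by
    rw [← hmid]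
    exact hmono (Set.mem_Iic.2 (by omega)) (Set.mem_Iic.2 (by omega)) (by omega)
  have hmr := hroot (N / 2 - 1) (by omega)
  have h0 := hroot (N / 2) (by omega)
  rw [hmid] at h0
  have hne : ∀ x ∈ Set.Ioo (ξ (N / 2 - 1)) 0, (lglPoly N).eval x ≠ 0 := by
    rintro x ⟨hx1, hx2⟩ hx
    obtain ⟨k, hk, rfl⟩ := hsurj x hx
    rw [← hmid] at hx2
    rw [hmono.lt_iff_lt (Set.mem_Iic.2 (by omega)) (Set.mem_Iic.2 (by omega))] at hx1 hx2
    omega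
  obtain ⟨c, ⟨hc1, hc2⟩, hc⟩ := exists_sturm_comparison_lglPoly hm0 h0 hmr hne
  rw [hmid, zero_sub]
  obtain ⟨h, hh⟩ : ∃ h, h = -ξ (N / 2 - 1) := ⟨_, rfl⟩
  rw [← hh]
  rw [show ξ (N / 2 - 1) = -h by linarith] at hc hc1 hm0
  have hn : (4 : ℝ) ≤ N := by exact_mod_cast hN
  generalize (N : ℝ) = n at *
  have hpi1 : 9 < Real.pi ^ 2 := by nlinarith [Real.pi_gt_three]
  have hpi2 : Real.pi ^ 2 < 10 := by nlinarith [Real.pi_lt_d2, Real.pi_pos]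
  generalize Real.pi ^ 2 = P at *
  have hch : c ^ 2 < h ^ 2 := by nlinarith
  have hc0 : 0 < c ^ 2 := by nlinarith
  have hl : 20 ≤ n * (n + 1) := by nlinarith
  have hlow : P * (1 - h ^ 2) < n * (n + 1) * h ^ 2 := by nlinarith
  have hupp : n * (n + 1) * h ^ 2 < 10 := by nlinarith
  constructor
  · rw [div_le_iff₀ (by linarith)]
    by_contra! hlt
    have hsq : h ^ 2 * (4 * (n * (n + 1)) + 1) < 9 := by
      have := mul_self_lt_mul_self (by nlinarith : 0 ≤ h * (2 * n + 1)) hlt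
      linarith
    have hh2 : h ^ 2 < 1 / 9 := by nlinarith
    nlinarith
  · rw [le_div_iff₀ (by positivity)]
    by_contra! hlt
    have hsq : (4 * n - 4) ^ 2 < (h * n ^ 2) ^ 2 := pow_lt_pow_left₀ hlt (by linarith) two_ne_zero
    have h1 : (4 * n - 4) ^ 2 * (n + 1) < n ^ 3 * (n * (n + 1) * h ^ 2) := by nlinarith
    have h2 : n ^ 3 * (n * (n + 1) * h ^ 2) ≤ n ^ 3 * 10 :=
      mul_le_mul_of_nonneg_left hupp.le (by positivity)
    have h3 : 4 * n ^ 2 ≤ n ^ 3 := by nlinarith [sq_nonneg n]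
    nlinarith
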